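/- arXiv:1911.05903 — 2 statements merged into one kernel-verified Lean document; each statement's English description precedes it below -/
import Mathlib

section
/- Let A be an n×n complex positive semidefinite matrix such that det(1 + A) = 1 + tr(A). Then Matrix.rank A ≤ 1. -/
open Matrix ComplexOrder

theorem Finset.one_add_sum_le_prod_one_add_of_nonneg {ι : Type*} (s : Finset ι) (f : ι → ℝ)
    (hf : ∀ i ∈ s, 0 ≤ f i) : 1 + ∑ i ∈ s, f i ≤ ∏ i ∈ s, (1 + f i) := by
  classical
  induction s using Finset.induction_on with
  | empty => simp
  | insert a s ha ih =>
    rw [Finset.sum_insert ha, Finset.prod_insert ha]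
    have h₁ := ih fun i hi => hf i (Finset.mem_insert_of_mem hi)
    have h₂ := hf a (Finset.mem_insert_self a s)
    have h₃ : 0 ≤ ∑ i ∈ s, f i :=
      Finset.sum_nonneg fun i hi => hf i (Finset.mem_insert_of_mem hi)
    nlinarith [mul_nonneg h₂ h₃, mul_le_mul_of_nonneg_left h₁ (by linarith : 0 ≤ 1 + f a)]

theorem Finset.one_add_sum_lt_prod_one_add_of_pos_of_pos {ι : Type*} [DecidableEq ι]
    {s : Finset ι} {f : ι → ℝ} (hf : ∀ i ∈ s, 0 ≤ f i) {i j : ι} (hi : i ∈ s) (hj : j ∈ s)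
    (hij : i ≠ j) (hfi : 0 < f i) (hfj : 0 < f j) :
    1 + ∑ k ∈ s, f k < ∏ k ∈ s, (1 + f k) := by
  have hj' : j ∈ s.erase i := Finset.mem_erase.2 ⟨hij.symm, hj⟩
  rw [← Finset.add_sum_erase s f hi, ← Finset.mul_prod_erase s (fun k => 1 + f k) hi,
    ← Finset.add_sum_erase _ f hj', ← Finset.mul_prod_erase _ (fun k => 1 + f k) hj']
  have hrest : ∀ k ∈ (s.erase i).erase j, 0 ≤ f k := fun k hk =>
    hf k (Finset.mem_of_mem_erase (Finset.mem_of_mem_erase hk))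
  have h₁ := Finset.one_add_sum_le_prod_one_add_of_nonneg _ f hrest
  have h₂ := Finset.sum_nonneg hrest
  have h₃ := mul_pos hfi hfj
  calc 1 + (f i + (f j + ∑ k ∈ (s.erase i).erase j, f k))
      < (1 + f i) * ((1 + f j) * (1 + ∑ k ∈ (s.erase i).erase j, f k)) := by
        nlinarith [mul_nonneg hfi.le h₂, mul_nonneg hfj.le h₂, mul_nonneg h₃.le h₂]
    _ ≤ _ := by gcongr

theorem Matrix.IsHermitian.det_one_add_eq_prod_eigenvalues {𝕜 n : Type*} [RCLike 𝕜] [Fintype n]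
    [DecidableEq n] {A : Matrix n n 𝕜} (hA : A.IsHermitian) :
    (1 + A).det = ∏ i, (1 + (hA.eigenvalues i : 𝕜)) := by
  have h := A.eval_charpoly (-1)
  rw [hA.charpoly_eq, Polynomial.eval_prod, map_neg, map_one, ← neg_add', Matrix.det_neg] at h
  simp only [Polynomial.eval_sub, Polynomial.eval_X, Polynomial.eval_C, ← neg_add',
    Finset.prod_neg, Finset.card_univ] at h
  exact (mul_left_cancel₀ (pow_ne_zero _ (neg_ne_zero.2 one_ne_zero)) h).symm

theorem rank_le_one_of_det_one_add_eq_one_add_trace {n : Type*} [Fintype n] [DecidableEq n]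
    (A : Matrix n n ℂ) (hA : A.PosSemidef) (hdet : (1 + A).det = 1 + A.trace) :
    A.rank ≤ 1 := by
  have hH := hA.isHermitian
  have hnn := hA.eigenvalues_nonneg
  rw [hH.det_one_add_eq_prod_eigenvalues, hH.trace_eq_sum_eigenvalues] at hdet
  have hreal : ∏ i, (1 + hH.eigenvalues i) = 1 + ∑ i, hH.eigenvalues i := by
    apply Complex.ofReal_injective
    push_cast
    exact hdet
  rw [hH.rank_eq_card_non_zero_eigs, Fintype.card_le_one_iff]
  rintro ⟨i, hi⟩ ⟨j, hj⟩
  by_contra hij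
  exact (Finset.one_add_sum_lt_prod_one_add_of_pos_of_pos (fun k _ => hnn k) (Finset.mem_univ i)
    (Finset.mem_univ j) (fun h => hij (Subtype.ext h)) ((hnn i).lt_of_ne' hi)
    ((hnn j).lt_of_ne' hj)).ne' hreal
end

section
/- Let E and S be n×n complex positive definite matrices, with N the cardinality of the index type n. Then −((S * E).trace).re + Real.log (S.det.re) + N ≤ −Real.log (E.det.re), and equality holds when S = E⁻¹. Consequently −ln det(E) equals the maximum over positive definite S of −tr(S E) + ln det(S) + N, attained at S = E⁻¹. -/
open Matrix ComplexOrder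

theorem Matrix.PosDef.log_det_add_card_le_trace {n : Type*} [Fintype n] [DecidableEq n]
    {A : Matrix n n ℂ} (hA : A.PosDef) :
    Real.log A.det.re + (Fintype.card n : ℝ) ≤ A.trace.re := by
  have hpos := hA.eigenvalues_pos
  rw [hA.1.det_eq_prod_eigenvalues, hA.1.trace_eq_sum_eigenvalues]
  simp only [Complex.coe_algebraMap, ← Complex.ofReal_prod, ← Complex.ofReal_sum,
    Complex.ofReal_re]
  rw [Real.log_prod fun i _ => (hpos i).ne']
  have h := Finset.sum_le_sum fun i (_ : i ∈ Finset.univ) =>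
    Real.log_le_sub_one_of_pos (hpos i)
  simp only [Finset.sum_sub_distrib, Finset.sum_const, Finset.card_univ, nsmul_eq_mul,
    mul_one] at h
  linarith

theorem Matrix.PosDef.exists_isUnit_eq_conjTranspose_mul_self {n : Type*} [Fintype n]
    [DecidableEq n] {A : Matrix n n ℂ} (hA : A.PosDef) :
    ∃ B : Matrix n n ℂ, IsUnit B ∧ A = Bᴴ * B := by
  open scoped MatrixOrder in
  obtain ⟨B, hB⟩ := CStarAlgebra.nonneg_iff_eq_star_mul_self.mp hA.posSemidef.nonneg
  refine ⟨B, ?_, hB⟩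
  have h := hA.isUnit
  rw [hB, Matrix.isUnit_iff_isUnit_det, det_mul] at h
  exact (Matrix.isUnit_iff_isUnit_det B).mpr (isUnit_of_mul_isUnit_right h)

theorem Matrix.PosDef.log_det_mul_re {n : Type*} [Fintype n] [DecidableEq n]
    {A B : Matrix n n ℂ} (hA : A.PosDef) (hB : B.PosDef) :
    Real.log (A * B).det.re = Real.log A.det.re + Real.log B.det.re := by
  obtain ⟨ha, ha'⟩ := Complex.pos_iff.mp hA.det_pos
  obtain ⟨hb, -⟩ := Complex.pos_iff.mp hB.det_pos
  rw [det_mul, Complex.mul_re, ← ha', zero_mul, sub_zero, Real.log_mul ha.ne' hb.ne']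

theorem neg_log_det_variational {n : Type*} [Fintype n] [DecidableEq n]
    (E S : Matrix n n ℂ) (hE : E.PosDef) (hS : S.PosDef) :
    (-(((S * E).trace).re) + Real.log (S.det.re) + (Fintype.card n : ℝ) ≤
        -Real.log (E.det.re)) ∧
      (S = E⁻¹ →
        -(((S * E).trace).re) + Real.log (S.det.re) + (Fintype.card n : ℝ) =
          -Real.log (E.det.re)) := by
  have hlog := hS.log_det_mul_re hE
  constructor
  · obtain ⟨B, hB, rfl⟩ := hE.exists_isUnit_eq_conjTranspose_mul_self
    have hP : (B * S * Bᴴ).PosDef :=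
      hS.mul_mul_conjTranspose_same (vecMul_injective_of_isUnit hB)
    have h := hP.log_det_add_card_le_trace
    have htr : (B * S * Bᴴ).trace = (S * (Bᴴ * B)).trace := by
      rw [Matrix.mul_assoc, trace_mul_comm, Matrix.mul_assoc]
    have hdet : (B * S * Bᴴ).det = (S * (Bᴴ * B)).det := by
      simp only [det_mul]; ring
    rw [htr, hdet, hlog] at h
    linarith
  · rintro rfl
    rw [nonsing_inv_mul _ ((isUnit_iff_isUnit_det E).mp hE.isUnit)] at hlog ⊢
    simp only [det_one, Complex.one_re, Real.log_one] at hlog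
    simp only [trace_one, Complex.natCast_re]
    linarith
end
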